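/- arXiv:1502.00471 — 6 statements merged into one kernel-verified Lean document; each statement's English description precedes it below -/
import Mathlib

section
/- Let M be a real symmetric p×p matrix with eigenvalues d₁ ≥ ... ≥ d_p listed in decreasing order, let κ ≥ 1, and let l : ℝ → ℝ be convex on (0,∞). For a symmetric positive definite Ω with eigenvalues λ₁(Ω) ≥ ... ≥ λ_p(Ω), define F(Ω) = ∑ᵢ l(λᵢ(Ω)) − Tr(ΩM). Then the infimum of F over Ω ∈ C_κ equals the infimum, over all u > 0 and all real vectors (λ₁, ..., λ_p) with u ≤ λᵢ ≤ κu for all i, of ∑ᵢ [l(λᵢ) − dᵢλᵢ]. -/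
namespace Matrix

variable {n : Type*} [Fintype n] [DecidableEq n] {A B : Matrix n n ℝ}

theorem sum_sq_row_of_mem_unitaryGroup {U : Matrix n n ℝ} (hU : U ∈ unitaryGroup n ℝ) (j : n) :
    ∑ i, U j i ^ 2 = 1 := by
  have h := congrFun (congrFun (mem_unitaryGroup_iff.1 hU) j) j
  simpa [mul_apply, star_eq_conjTranspose, sq] using h

theorem sum_sq_col_of_mem_unitaryGroup {U : Matrix n n ℝ} (hU : U ∈ unitaryGroup n ℝ) (i : n) :
    ∑ j, U j i ^ 2 = 1 := by
  have h := congrFun (congrFun (mem_unitaryGroup_iff'.1 hU) i) i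
  simpa [mul_apply, star_eq_conjTranspose, sq] using h

namespace IsHermitian

theorem eq_eigenvectorUnitary_mul_diagonal_mul_star (hA : A.IsHermitian) :
    A = (hA.eigenvectorUnitary : Matrix n n ℝ) * diagonal hA.eigenvalues *
      star (hA.eigenvectorUnitary : Matrix n n ℝ) := by
  simpa [Unitary.conjStarAlgAut_apply, Function.comp_def] using hA.spectral_theorem

theorem diag_apply_eq_sum_sq_mul_eigenvalues (hA : A.IsHermitian) (j : n) :
    A j j = ∑ i, (hA.eigenvectorUnitary : Matrix n n ℝ) j i ^ 2 * hA.eigenvalues i := by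
  conv_lhs => rw [hA.eq_eigenvectorUnitary_mul_diagonal_mul_star]
  rw [mul_apply]
  simp only [mul_diagonal, star_eq_conjTranspose, conjTranspose_apply, star_trivial]
  exact Finset.sum_congr rfl fun i _ => by ring

theorem diag_mem_of_eigenvalues_mem (hA : A.IsHermitian) {s : Set ℝ} (hs : Convex ℝ s)
    (h : ∀ i, hA.eigenvalues i ∈ s) (j : n) : A j j ∈ s := by
  rw [hA.diag_apply_eq_sum_sq_mul_eigenvalues]
  exact hs.sum_mem (fun _ _ => sq_nonneg _)
    (sum_sq_row_of_mem_unitaryGroup hA.eigenvectorUnitary.2 j) (fun i _ => h i)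

/-- A convex function has a smaller sum over the diagonal than over the eigenvalues. -/
theorem sum_diag_le_sum_eigenvalues (hA : A.IsHermitian) {s : Set ℝ} {f : ℝ → ℝ}
    (hf : ConvexOn ℝ s f) (h : ∀ i, hA.eigenvalues i ∈ s) :
    ∑ j, f (A j j) ≤ ∑ i, f (hA.eigenvalues i) := by
  have key (j : n) : f (A j j) ≤
      ∑ i, (hA.eigenvectorUnitary : Matrix n n ℝ) j i ^ 2 * f (hA.eigenvalues i) := by
    rw [hA.diag_apply_eq_sum_sq_mul_eigenvalues]
    exact hf.map_sum_le (fun _ _ => sq_nonneg _)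
      (sum_sq_row_of_mem_unitaryGroup hA.eigenvectorUnitary.2 j) (fun i _ => h i)
  refine (Finset.sum_le_sum fun j _ => key j).trans_eq ?_
  rw [Finset.sum_comm]
  simp_rw [← Finset.sum_mul, sum_sq_col_of_mem_unitaryGroup hA.eigenvectorUnitary.2, one_mul]

theorem map_eigenvalues_eq_of_charpoly_eq_diagonal (hA : A.IsHermitian) {x : n → ℝ}
    (h : A.charpoly = (diagonal x).charpoly) :
    Finset.univ.val.map hA.eigenvalues = Finset.univ.val.map x := by
  have h₁ := hA.roots_charpoly_eq_eigenvalues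
  rw [h, charpoly_diagonal, Polynomial.roots_prod _ _
    (Finset.prod_ne_zero_iff.2 fun i _ => Polynomial.X_sub_C_ne_zero (x i))] at h₁
  simpa [Function.comp_def] using h₁.symm

theorem eigenvalues_mem_of_map_eq (hA : A.IsHermitian) {x : n → ℝ}
    (h : Finset.univ.val.map hA.eigenvalues = Finset.univ.val.map x) {s : Set ℝ}
    (hx : ∀ i, x i ∈ s) (i : n) : hA.eigenvalues i ∈ s := by
  have hi : hA.eigenvalues i ∈ Finset.univ.val.map x :=
    h ▸ Multiset.mem_map_of_mem _ (Finset.mem_univ i)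
  obtain ⟨j, -, hj⟩ := Multiset.mem_map.1 hi
  exact hj ▸ hx j

theorem trace_mul_eq_sum (hB : B.IsHermitian) (A : Matrix n n ℝ) :
    (A * B).trace = ∑ j, (star (hB.eigenvectorUnitary : Matrix n n ℝ) * A *
      (hB.eigenvectorUnitary : Matrix n n ℝ)) j j * hB.eigenvalues j := by
  conv_lhs => rw [hB.eq_eigenvectorUnitary_mul_diagonal_mul_star]
  rw [← mul_assoc, trace_mul_comm, ← mul_assoc, ← mul_assoc]
  simp only [trace, diag_apply, mul_diagonal]

end IsHermitian

end Matrix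

theorem Real.sInf_eq_of_subset_of_forall_exists_le {S T : Set ℝ} (hTS : T ⊆ S)
    (h : ∀ s ∈ S, ∃ t ∈ T, t ≤ s) : sInf S = sInf T := by
  rcases T.eq_empty_or_nonempty with rfl | hT
  · rw [Set.eq_empty_of_forall_notMem (s := S) fun s hs => by simpa using h s hs]
  by_cases hb : BddBelow T
  · have hbS : BddBelow S := by
      obtain ⟨b, hb⟩ := hb
      exact ⟨b, fun s hs => let ⟨t, ht, hts⟩ := h s hs; (hb ht).trans hts⟩
    refine le_antisymm (csInf_le_csInf hbS hT hTS) (le_csInf (hT.mono hTS) fun s hs => ?_)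
    obtain ⟨t, ht, hts⟩ := h s hs
    exact (csInf_le hb ht).trans hts
  · rw [Real.sInf_of_not_bddBelow hb, Real.sInf_of_not_bddBelow fun hS => hb (hS.mono hTS)]


open Matrix

/-- The largest eigenvalue of a real symmetric matrix. -/
noncomputable def lamMax {p : ℕ} {Ω : Matrix (Fin p) (Fin p) ℝ} (hΩ : Ω.IsHermitian) : ℝ :=
  ⨆ i, hΩ.eigenvalues i

/-- The smallest eigenvalue of a real symmetric matrix. -/
noncomputable def lamMin {p : ℕ} {Ω : Matrix (Fin p) (Fin p) ℝ} (hΩ : Ω.IsHermitian) : ℝ :=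
  ⨅ i, hΩ.eigenvalues i

/-- The infimum over `C_κ` of `F(Ω) = ∑ᵢ l(λᵢ(Ω)) − Tr(ΩM)` equals the infimum,
over all `u > 0` and all vectors `λ` with `u ≤ λᵢ ≤ κu`, of `∑ᵢ (l(λᵢ) − dᵢλᵢ)`, where
`d₁ ≥ ... ≥ d_p` are the eigenvalues of the symmetric matrix `M` in decreasing order. -/
theorem stmt7 {p : ℕ} (hp : 1 ≤ p) (κ : ℝ) (hκ : 1 ≤ κ)
    (M : Matrix (Fin p) (Fin p) ℝ) (hM : M.IsHermitian)
    (d : Fin p → ℝ) (hd : Antitone d) (σ : Equiv.Perm (Fin p))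
    (hdeig : ∀ i, d i = hM.eigenvalues (σ i))
    (l : ℝ → ℝ) (hl : ConvexOn ℝ (Set.Ioi (0 : ℝ)) l) :
    sInf {y : ℝ | ∃ (Ω : Matrix (Fin p) (Fin p) ℝ) (hΩ : Ω.PosDef),
        lamMax hΩ.1 ≤ κ * lamMin hΩ.1 ∧
        y = (∑ i, l (hΩ.1.eigenvalues i)) - (Ω * M).trace} =
      sInf {y : ℝ | ∃ u : ℝ, 0 < u ∧ ∃ lam : Fin p → ℝ,
        (∀ i, lam i ∈ Set.Icc u (κ * u)) ∧ y = ∑ i, (l (lam i) - d i * lam i)} := by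
  have : Nonempty (Fin p) := ⟨⟨0, hp⟩⟩
  set V : Matrix (Fin p) (Fin p) ℝ := (hM.eigenvectorUnitary : Matrix (Fin p) (Fin p) ℝ) with hV
  have hVV : star V * V = 1 := mem_unitaryGroup_iff'.1 hM.eigenvectorUnitary.2
  have hVV' : V * star V = 1 := mem_unitaryGroup_iff.1 hM.eigenvectorUnitary.2
  apply Real.sInf_eq_of_subset_of_forall_exists_le
  · rintro y ⟨u, hu, lam, hlam, rfl⟩
    have hx (i : Fin p) : lam (σ.symm i) ∈ Set.Icc u (κ * u) := hlam _
    set x : Fin p → ℝ := fun i => lam (σ.symm i) with hxdef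
    have hH : (V * diagonal x * star V).IsHermitian :=
      isHermitian_mul_mul_conjTranspose V (isHermitian_diagonal x)
    have hmap := hH.map_eigenvalues_eq_of_charpoly_eq_diagonal (x := x) (by
      rw [charpoly_mul_comm, ← mul_assoc, hVV, one_mul])
    have hmem := hH.eigenvalues_mem_of_map_eq hmap hx
    refine ⟨V * diagonal x * star V,
      hH.posDef_iff_eigenvalues_pos.2 fun i => hu.trans_le (hmem i).1, ?_, ?_⟩
    · exact (ciSup_le fun i => (hmem i).2).trans
        (mul_le_mul_of_nonneg_left (le_ciInf fun i => (hmem i).1) (zero_le_one.trans hκ))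
    · have hsum : ∑ i, l (hH.eigenvalues i) = ∑ i, l (x i) := by
        simpa [Multiset.map_map, Function.comp_def, List.sum_ofFn] using
          congrArg (fun m : Multiset ℝ => (m.map l).sum) hmap
      have hconj : star V * (V * diagonal x * star V) * V = diagonal x := by
        rw [← mul_assoc, ← mul_assoc, hVV, one_mul, mul_assoc, hVV, mul_one]
      rw [hsum, hM.trace_mul_eq_sum, ← hV, hconj, ← Finset.sum_sub_distrib,
        ← Equiv.sum_comp σ fun i => l (x i) - diagonal x i i * hM.eigenvalues i]
      exact Finset.sum_congr rfl fun i _ => by simp [hxdef, hdeig, mul_comm]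
  · rintro y ⟨Ω, hΩ, hκΩ, rfl⟩
    have hA : (star V * Ω * V).IsHermitian := isHermitian_conjTranspose_mul_mul V hΩ.1
    have heig : hA.eigenvalues = hΩ.1.eigenvalues := by
      rw [IsHermitian.eigenvalues_eq_eigenvalues_iff, charpoly_mul_comm, ← mul_assoc, hVV',
        one_mul]
    have hmin (i : Fin p) : lamMin hΩ.1 ≤ hΩ.1.eigenvalues i :=
      ciInf_le (Set.finite_range _).bddBelow i
    have hmax (i : Fin p) : hΩ.1.eigenvalues i ≤ lamMax hΩ.1 :=
      le_ciSup (Set.finite_range _).bddAbove i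
    have hu : 0 < lamMin hΩ.1 := by
      obtain ⟨i, hi⟩ := exists_eq_ciInf_of_finite (f := hΩ.1.eigenvalues)
      exact (hΩ.eigenvalues_pos i).trans_eq hi
    refine ⟨_, ⟨lamMin hΩ.1, hu, fun i => (star V * Ω * V) (σ i) (σ i), fun i => ?_, rfl⟩, ?_⟩
    · exact hA.diag_mem_of_eigenvalues_mem (convex_Icc _ _)
        (fun j => heig ▸ ⟨hmin j, (hmax j).trans hκΩ⟩) (σ i)
    · have hle := hA.sum_diag_le_sum_eigenvalues hl (fun i => heig ▸ hΩ.eigenvalues_pos i)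
      rw [heig] at hle
      simp_rw [hdeig]
      rw [Equiv.sum_comp σ fun j => l ((star V * Ω * V) j j) -
          hM.eigenvalues j * (star V * Ω * V) j j,
        hM.trace_mul_eq_sum, ← hV, Finset.sum_sub_distrib]
      simp_rw [mul_comm (hM.eigenvalues _)]
      exact sub_le_sub_right hle _
end

section
/- (Solution characterization.) Let M be a real symmetric p×p matrix with spectral decomposition M = V D Vᵀ, where V is orthogonal and D = diag(d₁, ..., d_p) with d₁ ≥ ... ≥ d_p. Let κ ≥ 1 and let l : ℝ → ℝ be convex on (0,∞). For each i suppose λ̃ᵢ > 0 is a global minimizer of λ ↦ l(λ) − dᵢλ over (0,∞), and set λ*ᵢ(u) = max(u, min(λ̃ᵢ, κu)) for u > 0. Suppose u* > 0 minimizes the function u ↦ ∑ᵢ [l(λ*ᵢ(u)) − dᵢ λ*ᵢ(u)] over (0,∞). Then Ω* = V diag(λ*₁(u*), ..., λ*_p(u*)) Vᵀ belongs to C_κ and satisfies ∑ᵢ l(λᵢ(Ω*)) − Tr(Ω* M) ≤ ∑ᵢ l(λᵢ(Ω)) − Tr(Ω M) for every Ω ∈ C_κ, where λ₁(Ω) ≥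 ... ≥ λ_p(Ω) are the eigenvalues of Ω. -/
open Matrix

/-- Clamping the minimizer of a convex function to `[a, b]` minimizes the function on `[a, b]`. -/
theorem ConvexOn.clamp_minimizer_le {g : ℝ → ℝ} {s : Set ℝ} (hg : ConvexOn ℝ s g) {t a b x : ℝ}
    (ht : t ∈ s) (hx : x ∈ s) (hmin : ∀ y ∈ s, g t ≤ g y) (hax : a ≤ x) (hxb : x ≤ b) :
    g (max a (min t b)) ≤ g x := by
  rcases le_total t b with htb | hbt
  · rw [min_eq_left htb]
    rcases le_total a t with hat | hta
    · rw [max_eq_right hat]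
      exact hmin x hx
    · rw [max_eq_left hta]
      exact (hg.le_max_of_mem_Icc ht hx ⟨hta, hax⟩).trans (max_le (hmin x hx) le_rfl)
  · rw [min_eq_right hbt, max_eq_right (hax.trans hxb)]
    exact (hg.le_max_of_mem_Icc hx ht ⟨hxb, hbt⟩).trans (max_le le_rfl (hmin x hx))

namespace Matrix

variable {n : Type*} [Fintype n] [DecidableEq n]

theorem trace_mul_diagonal_mul_transpose_mul_diagonal (W : Matrix n n ℝ) (e d : n → ℝ) :
    (W * diagonal e * Wᵀ * diagonal d).trace = ∑ i, ∑ j, W i j ^ 2 * (d i * e j) := by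
  simp only [trace, diag_apply, mul_diagonal]
  refine Finset.sum_congr rfl fun i _ => ?_
  rw [mul_apply, Finset.sum_mul]
  refine Finset.sum_congr rfl fun j _ => ?_
  rw [mul_diagonal, transpose_apply]
  ring

theorem sum_sq_row_eq_one {W : Matrix n n ℝ} (hW : W * Wᵀ = 1) (i : n) : ∑ j, W i j ^ 2 = 1 := by
  have h := congrFun (congrFun hW i) i
  simpa only [mul_apply, transpose_apply, one_apply_eq, ← sq] using h

theorem sum_sq_col_eq_one {W : Matrix n n ℝ} (hW : Wᵀ * W = 1) (j : n) : ∑ i, W i j ^ 2 = 1 := by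
  have h := congrFun (congrFun hW j) j
  simpa only [mul_apply, transpose_apply, one_apply_eq, ← sq] using h

theorem trace_conj_diagonal_mul_conj_diagonal {V : Matrix n n ℝ} (hV : Vᵀ * V = 1)
    (a d : n → ℝ) :
    (V * diagonal a * Vᵀ * (V * diagonal d * Vᵀ)).trace = ∑ i, d i * a i := by
  have h : V * diagonal a * Vᵀ * (V * diagonal d * Vᵀ)
      = V * (diagonal a * (Vᵀ * V) * diagonal d * Vᵀ) := by
    simp only [Matrix.mul_assoc]
  rw [h, trace_mul_comm, hV, Matrix.mul_one, Matrix.mul_assoc, hV, Matrix.mul_one,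
    diagonal_mul_diagonal, trace_diagonal]
  exact Finset.sum_congr rfl fun i _ => mul_comm _ _

/-- In the joint eigenbases, the objective `∑ l(eⱼ) - tr(Ω M)` is a doubly stochastic average of
the scalar objectives, so it is bounded below by rowwise lower bounds. -/
theorem sum_le_sum_sub_trace_of_forall_le {V Ω : Matrix n n ℝ} (hV : Vᵀ * V = 1)
    (hΩ : Ω.IsHermitian) (l : ℝ → ℝ) (d c : n → ℝ)
    (hc : ∀ i j, c i ≤ l (hΩ.eigenvalues j) - d i * hΩ.eigenvalues j) :
    ∑ i, c i ≤ ∑ i, l (hΩ.eigenvalues i) - (Ω * (V * diagonal d * Vᵀ)).trace := by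
  set e := hΩ.eigenvalues with he
  obtain ⟨U, hU, hU', hspec⟩ :
      ∃ U : Matrix n n ℝ, Uᵀ * U = 1 ∧ U * Uᵀ = 1 ∧ Ω = U * diagonal e * Uᵀ := by
    refine ⟨hΩ.eigenvectorUnitary, ?_, ?_, ?_⟩
    · exact Unitary.coe_star_mul_self hΩ.eigenvectorUnitary
    · exact Unitary.coe_mul_star_self hΩ.eigenvectorUnitary
    · exact hΩ.spectral_theorem
  have hV' : V * Vᵀ = 1 := mul_eq_one_comm.mp hV
  set W := Vᵀ * U with hWdef
  have hW : Wᵀ * W = 1 := by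
    rw [hWdef, transpose_mul, transpose_transpose, Matrix.mul_assoc, ← Matrix.mul_assoc V, hV',
      Matrix.one_mul, hU]
  have hW' : W * Wᵀ = 1 := mul_eq_one_comm.mp hW
  have htr : (Ω * (V * diagonal d * Vᵀ)).trace = ∑ i, ∑ j, W i j ^ 2 * (d i * e j) := by
    rw [← trace_mul_diagonal_mul_transpose_mul_diagonal, ← Matrix.mul_assoc, trace_mul_comm,
      hspec, hWdef, transpose_mul, transpose_transpose]
    simp only [Matrix.mul_assoc]
  have hl : ∑ j, l (e j) = ∑ i, ∑ j, W i j ^ 2 * l (e j) := by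
    rw [Finset.sum_comm]
    refine Finset.sum_congr rfl fun j _ => ?_
    rw [← Finset.sum_mul, sum_sq_col_eq_one hW, one_mul]
  rw [htr, hl, ← Finset.sum_sub_distrib]
  refine Finset.sum_le_sum fun i _ => ?_
  rw [← Finset.sum_sub_distrib]
  calc c i = ∑ j, W i j ^ 2 * c i := by
        rw [← Finset.sum_mul, sum_sq_row_eq_one hW', one_mul]
    _ ≤ _ := Finset.sum_le_sum fun j _ => by
        rw [← mul_sub]
        exact mul_le_mul_of_nonneg_left (hc i j) (sq_nonneg _)

theorem posDef_conj_diagonal {V : Matrix n n ℝ} (hV : Vᵀ * V = 1) {a : n → ℝ}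
    (ha : ∀ i, 0 < a i) : (V * diagonal a * Vᵀ).PosDef := by
  have hVu : IsUnit V := IsUnit.of_mul_eq_one Vᵀ (mul_eq_one_comm.mp hV)
  have h := (IsUnit.posDef_star_right_conjugate_iff hVu).mpr (PosDef.diagonal ha)
  rwa [star_eq_conjTranspose, conjTranspose_eq_transpose_of_trivial] at h

theorem eigenvalues_conj_diagonal_mem_range {V : Matrix n n ℝ} (hV : Vᵀ * V = 1) {a : n → ℝ}
    (hA : (V * diagonal a * Vᵀ).IsHermitian) (i : n) : hA.eigenvalues i ∈ Set.range a := by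
  let u : (Matrix n n ℝ)ˣ := ⟨V, Vᵀ, mul_eq_one_comm.mp hV, hV⟩
  have hu : V * diagonal a * Vᵀ = u * diagonal a * (u⁻¹ : (Matrix n n ℝ)ˣ) := rfl
  have hspec : spectrum ℝ (V * diagonal a * Vᵀ) = Set.range a := by
    rw [hu, spectrum.units_conjugate, spectrum_diagonal]
  exact hspec ▸ hA.eigenvalues_mem_spectrum_real i

end Matrix

/-- solution characterization: with `M = V D Vᵀ` (`V` orthogonal,
`D = diag(d)`, `d` decreasing), `λ̃ᵢ > 0` a global minimizer of `l(λ) − dᵢλ` over `(0,∞)`,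
`λ*ᵢ(u) = max(u, min(λ̃ᵢ, κu))`, and `u* > 0` a global minimizer of
`u ↦ ∑ᵢ (l(λ*ᵢ(u)) − dᵢλ*ᵢ(u))` over `(0,∞)`, the matrix
`Ω* = V diag(λ*(u*)) Vᵀ` belongs to `C_κ` and minimizes
`∑ᵢ l(λᵢ(Ω)) − Tr(ΩM)` over `C_κ`. -/
theorem stmt8 {p : ℕ} (hp : 1 ≤ p) (κ : ℝ) (hκ : 1 ≤ κ)
    (M V : Matrix (Fin p) (Fin p) ℝ) (d : Fin p → ℝ) (hd : Antitone d)
    (hV : Vᵀ * V = 1) (hM : M = V * Matrix.diagonal d * Vᵀ)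
    (l : ℝ → ℝ) (hl : ConvexOn ℝ (Set.Ioi (0 : ℝ)) l)
    (lt : Fin p → ℝ) (hlt : ∀ i, 0 < lt i)
    (hmin : ∀ i, ∀ x ∈ Set.Ioi (0 : ℝ), l (lt i) - d i * lt i ≤ l x - d i * x)
    (ustar : ℝ) (hustar : 0 < ustar)
    (hustarmin : ∀ u ∈ Set.Ioi (0 : ℝ),
      (∑ i, (l (max ustar (min (lt i) (κ * ustar))) - d i * max ustar (min (lt i) (κ * ustar)))) ≤
        ∑ i, (l (max u (min (lt i) (κ * u))) - d i * max u (min (lt i) (κ * u)))) :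
    (∃ hstar : (V * Matrix.diagonal (fun i => max ustar (min (lt i) (κ * ustar))) * Vᵀ).PosDef,
        lamMax hstar.1 ≤ κ * lamMin hstar.1) ∧
      ∀ (Ω : Matrix (Fin p) (Fin p) ℝ) (hΩ : Ω.PosDef),
        lamMax hΩ.1 ≤ κ * lamMin hΩ.1 →
        (∑ i, l (max ustar (min (lt i) (κ * ustar)))) -
            ((V * Matrix.diagonal (fun i => max ustar (min (lt i) (κ * ustar))) * Vᵀ) * M).trace ≤
          (∑ i, l (hΩ.1.eigenvalues i)) - (Ω * M).trace := by
  subst hM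
  have : Nonempty (Fin p) := ⟨⟨0, hp⟩⟩
  constructor
  · have hle : ∀ i, ustar ≤ max ustar (min (lt i) (κ * ustar)) := fun i => le_max_left _ _
    have hge : ∀ i, max ustar (min (lt i) (κ * ustar)) ≤ κ * ustar := fun i =>
      max_le (le_mul_of_one_le_left hustar.le hκ) (min_le_right _ _)
    refine ⟨Matrix.posDef_conj_diagonal hV fun i => hustar.trans_le (hle i), ?_⟩
    refine (ciSup_le fun i => ?_).trans
      (mul_le_mul_of_nonneg_left (le_ciInf (c := ustar) fun i => ?_) (zero_le_one.trans hκ))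
    · obtain ⟨j, hj⟩ := Matrix.eigenvalues_conj_diagonal_mem_range hV _ i
      exact hj ▸ hge j
    · obtain ⟨j, hj⟩ := Matrix.eigenvalues_conj_diagonal_mem_range hV _ i
      exact hj ▸ hle j
  · intro Ω hΩ hcond
    have hmin_le : ∀ j, lamMin hΩ.1 ≤ hΩ.1.eigenvalues j := fun j =>
      ciInf_le (Set.finite_range _).bddBelow j
    have hle_max : ∀ j, hΩ.1.eigenvalues j ≤ lamMax hΩ.1 := fun j =>
      le_ciSup (Set.finite_range _).bddAbove j
    have hpos : 0 < lamMin hΩ.1 := by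
      obtain ⟨j, hj⟩ := exists_eq_ciInf_of_finite (f := hΩ.1.eigenvalues)
      exact (hΩ.eigenvalues_pos j).trans_eq hj
    rw [Matrix.trace_conj_diagonal_mul_conj_diagonal hV, ← Finset.sum_sub_distrib]
    refine (hustarmin _ hpos).trans
      (Matrix.sum_le_sum_sub_trace_of_forall_le hV hΩ.1 l d _ fun i j => ?_)
    have hg : ConvexOn ℝ (Set.Ioi (0 : ℝ)) fun x => l x - d i * x :=
      hl.sub ((LinearMap.mulLeft ℝ (d i)).concaveOn (convex_Ioi 0))
    exact hg.clamp_minimizer_le (hlt i) (hΩ.eigenvalues_pos j) (hmin i) (hmin_le j)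
      ((hle_max j).trans hcond)
end

section
/- (Condition-number-regularized Gaussian maximum likelihood.) Let S be a real symmetric positive definite p×p matrix with spectral decomposition S = Q diag(s₁, ..., s_p) Qᵀ, Q orthogonal, s₁ ≥ ... ≥ s_p > 0, and let κ ≥ 1. For u > 0 set λ*ᵢ(u) = max(u, min(1/sᵢ... specifically λ*ᵢ(u) = max(u, min(1/s_{p−i+1}, κu)) when eigenvalues of −S are sorted decreasingly; equivalently, define for each i the truncation μᵢ(u) = min(κu, max(u, 1/sᵢ)). Suppose u* > 0 minimizes u ↦ ∑ᵢ [sᵢ μᵢ(u) − log μᵢ(u)] over (0,∞). Then Ω* = Q diag(μ₁(u*), ..., μ_p(u*)) Qᵀ minimizes Tr(SΩ) − log det Ω over all Ω ∈ C_κ. -/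
open Matrix

lemma Matrix.IsHermitian.exists_orthogonal_diagonalization {n : Type*} [Fintype n] [DecidableEq n]
    {A : Matrix n n ℝ} (hA : A.IsHermitian) :
    ∃ V : Matrix n n ℝ, Vᵀ * V = 1 ∧ A = V * diagonal hA.eigenvalues * Vᵀ := by
  refine ⟨hA.eigenvectorUnitary, ?_, ?_⟩
  · simpa [star_eq_conjTranspose] using Unitary.coe_star_mul_self hA.eigenvectorUnitary
  · have h := hA.spectral_theorem
    rw [Unitary.conjStarAlgAut_apply] at h
    simpa [star_eq_conjTranspose, Function.comp_def] using h

section Orthogonal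

variable {n : Type*} [Fintype n] [DecidableEq n]

lemma sum_sq_row_of_transpose_mul_self {R : Matrix n n ℝ} (hR : Rᵀ * R = 1) (i : n) :
    ∑ j, R i j ^ 2 = 1 := by
  have hR' : R * Rᵀ = 1 := mul_eq_one_comm.mp hR
  have h := congrFun (congrFun hR' i) i
  simpa [mul_apply, sq] using h

lemma sum_sq_col_of_transpose_mul_self {R : Matrix n n ℝ} (hR : Rᵀ * R = 1) (j : n) :
    ∑ i, R i j ^ 2 = 1 := by
  have h := congrFun (congrFun hR j) j
  simpa [mul_apply, sq] using h

lemma transpose_mul_orthogonal {Q V : Matrix n n ℝ} (hQ : Qᵀ * Q = 1) (hV : Vᵀ * V = 1) :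
    (Qᵀ * V)ᵀ * (Qᵀ * V) = 1 := by
  rw [transpose_mul, transpose_transpose, Matrix.mul_assoc, ← Matrix.mul_assoc Q,
    mul_eq_one_comm.mp hQ, Matrix.one_mul, hV]

lemma trace_orthogonal_conj_diagonal_mul (Q V : Matrix n n ℝ) (a b : n → ℝ) :
    ((Q * diagonal a * Qᵀ) * (V * diagonal b * Vᵀ)).trace =
      ∑ i, ∑ j, (Qᵀ * V) i j ^ 2 * (a i * b j) := by
  have h : ((Q * diagonal a * Qᵀ) * (V * diagonal b * Vᵀ)).trace =
      (diagonal a * ((Qᵀ * V) * diagonal b * (Qᵀ * V)ᵀ)).trace := by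
    rw [Matrix.mul_assoc Q, Matrix.mul_assoc Q, trace_mul_comm]
    simp only [transpose_mul, transpose_transpose, Matrix.mul_assoc]
  rw [h, trace]
  refine Finset.sum_congr rfl fun i _ => ?_
  rw [diag_apply, diagonal_mul, mul_apply, Finset.mul_sum]
  refine Finset.sum_congr rfl fun j _ => ?_
  rw [mul_diagonal, transpose_apply]
  ring

lemma det_orthogonal_conj_diagonal {Q : Matrix n n ℝ} (hQ : Qᵀ * Q = 1) (a : n → ℝ) :
    (Q * diagonal a * Qᵀ).det = ∏ i, a i := by
  rw [Matrix.mul_assoc, det_mul_comm, Matrix.mul_assoc, hQ, Matrix.mul_one, det_diagonal]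

lemma trace_orthogonal_conj_diagonal_mul_self {Q : Matrix n n ℝ} (hQ : Qᵀ * Q = 1) (a b : n → ℝ) :
    ((Q * diagonal a * Qᵀ) * (Q * diagonal b * Qᵀ)).trace = ∑ i, a i * b i := by
  rw [trace_orthogonal_conj_diagonal_mul, hQ]
  simp [one_apply]

lemma Matrix.IsHermitian.eigenvalues_mem_Icc_of_orthogonal_conj {Q : Matrix n n ℝ} {m : n → ℝ}
    (hQ : Qᵀ * Q = 1) (hA : (Q * diagonal m * Qᵀ).IsHermitian) {l u : ℝ}
    (hm : ∀ i, m i ∈ Set.Icc l u) (j : n) : hA.eigenvalues j ∈ Set.Icc l u := by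
  obtain ⟨V, hV, hAV⟩ := hA.exists_orthogonal_diagonalization
  have hR := sum_sq_col_of_transpose_mul_self (transpose_mul_orthogonal hQ hV) j
  have hj : hA.eigenvalues j = ∑ i, (Qᵀ * V) i j ^ 2 * m i := by
    have h : diagonal hA.eigenvalues = (Qᵀ * V)ᵀ * diagonal m * (Qᵀ * V) := by
      calc diagonal hA.eigenvalues
          = (Vᵀ * V) * diagonal hA.eigenvalues * (Vᵀ * V) := by simp [hV]
        _ = Vᵀ * (V * diagonal hA.eigenvalues * Vᵀ) * V := by simp only [Matrix.mul_assoc]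
        _ = Vᵀ * (Q * diagonal m * Qᵀ) * V := by rw [← hAV]
        _ = _ := by simp only [transpose_mul, transpose_transpose, Matrix.mul_assoc]
    have h' := congrFun (congrFun h j) j
    rw [diagonal_apply_eq, mul_apply] at h'
    rw [h']
    refine Finset.sum_congr rfl fun i _ => ?_
    rw [mul_diagonal, transpose_apply]
    ring
  rw [hj]
  constructor
  · calc l = ∑ i, (Qᵀ * V) i j ^ 2 * l := by rw [← Finset.sum_mul, hR, one_mul]
      _ ≤ _ := Finset.sum_le_sum fun i _ => mul_le_mul_of_nonneg_left (hm i).1 (sq_nonneg _)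
  · calc ∑ i, (Qᵀ * V) i j ^ 2 * m i ≤ ∑ i, (Qᵀ * V) i j ^ 2 * u :=
          Finset.sum_le_sum fun i _ => mul_le_mul_of_nonneg_left (hm i).2 (sq_nonneg _)
      _ = u := by rw [← Finset.sum_mul, hR, one_mul]

/-- If every `c i` is a lower bound for `a i * b j - log (b j)`, then `∑ i, c i` is a lower bound
for the Gaussian negative log-likelihood at the matrix with eigenvalues `b`. -/
lemma sum_le_trace_sub_log_det {Q V : Matrix n n ℝ} (hQ : Qᵀ * Q = 1) (hV : Vᵀ * V = 1)
    (a b c : n → ℝ) (hb : ∀ j, 0 < b j) (hc : ∀ i j, c i ≤ a i * b j - Real.log (b j)) :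
    ∑ i, c i ≤ ((Q * diagonal a * Qᵀ) * (V * diagonal b * Vᵀ)).trace -
      Real.log (V * diagonal b * Vᵀ).det := by
  have hR := transpose_mul_orthogonal hQ hV
  rw [trace_orthogonal_conj_diagonal_mul, det_orthogonal_conj_diagonal hV,
    Real.log_prod fun j _ => (hb j).ne']
  have hlog : ∑ j, Real.log (b j) = ∑ i, ∑ j, (Qᵀ * V) i j ^ 2 * Real.log (b j) := by
    rw [Finset.sum_comm]
    simp only [← Finset.sum_mul, sum_sq_col_of_transpose_mul_self hR, one_mul]
  rw [hlog, ← Finset.sum_sub_distrib]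
  refine Finset.sum_le_sum fun i _ => ?_
  rw [← Finset.sum_sub_distrib]
  calc c i = ∑ j, (Qᵀ * V) i j ^ 2 * c i := by
        rw [← Finset.sum_mul, sum_sq_row_of_transpose_mul_self hR, one_mul]
    _ ≤ _ := Finset.sum_le_sum fun j _ => by
        rw [← mul_sub]
        exact mul_le_mul_of_nonneg_left (hc i j) (sq_nonneg _)

end Orthogonal

lemma truncation_mem_Icc {l u x : ℝ} (h : l ≤ u) : min u (max l x) ∈ Set.Icc l u :=
  ⟨le_min h (le_max_left _ _), min_le_left _ _⟩

/-- The truncation of `1 / s` to `[l, u]` minimizes `s * x - log x` over `[l, u]`. -/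
lemma mul_truncation_sub_log_le {s l u x : ℝ} (hs : 0 < s) (hl : 0 < l) (hx : x ∈ Set.Icc l u) :
    s * min u (max l (1 / s)) - Real.log (min u (max l (1 / s))) ≤ s * x - Real.log x := by
  have hlu : l ≤ u := hx.1.trans hx.2
  have hx0 : 0 < x := hl.trans_le hx.1
  have key : 0 < min u (max l (1 / s)) ∧
      0 ≤ (s * min u (max l (1 / s)) - 1) * (x - min u (max l (1 / s))) := by
    refine ⟨hl.trans_le (truncation_mem_Icc hlu).1, ?_⟩
    rcases le_total (1 / s) l with h | h
    · rw [max_eq_left h, min_eq_right hlu]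
      rw [div_le_iff₀ hs] at h
      exact mul_nonneg (by linarith) (by linarith [hx.1])
    · rw [max_eq_right h]
      rcases le_total (1 / s) u with h' | h'
      · rw [min_eq_right h', mul_one_div_cancel hs.ne']
        simp
      · rw [min_eq_left h']
        rw [le_div_iff₀ hs] at h'
        exact mul_nonneg_of_nonpos_of_nonpos (by linarith) (by linarith [hx.2])
  generalize min u (max l (1 / s)) = m at key
  obtain ⟨hm, hprod⟩ := key
  have hlog := Real.log_le_sub_one_of_pos (div_pos hx0 hm)
  rw [Real.log_div hx0.ne' hm.ne'] at hlog
  have hdiv : x / m - 1 ≤ s * (x - m) := by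
    rw [div_sub_one hm.ne', div_le_iff₀ hm]
    linarith
  linarith

/-- condition-number-regularized Gaussian maximum likelihood:
with `S = Q diag(s) Qᵀ` positive definite (`Q` orthogonal, `s` decreasing, `s_p > 0`),
`μᵢ(u) = min(κu, max(u, 1/sᵢ))`, and `u* > 0` a global minimizer of
`u ↦ ∑ᵢ (sᵢ μᵢ(u) − log μᵢ(u))` over `(0,∞)`, the matrix `Ω* = Q diag(μ(u*)) Qᵀ`
minimizes `Tr(SΩ) − log det Ω` over `C_κ`. -/
theorem stmt9 {p : ℕ} (hp : 1 ≤ p) (κ : ℝ) (hκ : 1 ≤ κ)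
    (S Q : Matrix (Fin p) (Fin p) ℝ) (s : Fin p → ℝ) (hs : Antitone s)
    (hspos : ∀ i, 0 < s i)
    (hQ : Qᵀ * Q = 1) (hS : S = Q * Matrix.diagonal s * Qᵀ)
    (ustar : ℝ) (hustar : 0 < ustar)
    (hustarmin : ∀ u ∈ Set.Ioi (0 : ℝ),
      (∑ i, (s i * min (κ * ustar) (max ustar (1 / s i)) -
          Real.log (min (κ * ustar) (max ustar (1 / s i))))) ≤
        ∑ i, (s i * min (κ * u) (max u (1 / s i)) -
          Real.log (min (κ * u) (max u (1 / s i))))) :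
    (∃ hstar : (Q * Matrix.diagonal (fun i => min (κ * ustar) (max ustar (1 / s i))) * Qᵀ).PosDef,
        lamMax hstar.1 ≤ κ * lamMin hstar.1) ∧
      ∀ (Ω : Matrix (Fin p) (Fin p) ℝ) (hΩ : Ω.PosDef),
        lamMax hΩ.1 ≤ κ * lamMin hΩ.1 →
        (S * (Q * Matrix.diagonal (fun i => min (κ * ustar) (max ustar (1 / s i))) * Qᵀ)).trace -
            Real.log (Q * Matrix.diagonal (fun i => min (κ * ustar) (max ustar (1 / s i))) * Qᵀ).det ≤
          (S * Ω).trace - Real.log Ω.det := by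
  have : Nonempty (Fin p) := ⟨⟨0, hp⟩⟩
  have scale {u : ℝ} (hu : 0 < u) : u ≤ κ * u := le_mul_of_one_le_left hu.le hκ
  have hμ (i : Fin p) := truncation_mem_Icc (x := 1 / s i) (scale hustar)
  constructor
  · have hA : (Q * Matrix.diagonal (fun i => min (κ * ustar) (max ustar (1 / s i))) *
        Qᵀ).IsHermitian := by
      simpa using isHermitian_mul_mul_conjTranspose Q
        (isHermitian_diagonal fun i => min (κ * ustar) (max ustar (1 / s i)))
    have hev := hA.eigenvalues_mem_Icc_of_orthogonal_conj hQ hμ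
    refine ⟨hA.posDef_iff_eigenvalues_pos.mpr fun j => hustar.trans_le (hev j).1, ?_⟩
    calc lamMax hA ≤ κ * ustar := ciSup_le fun j => (hev j).2
      _ ≤ κ * lamMin hA :=
        mul_le_mul_of_nonneg_left (le_ciInf fun j => (hev j).1) (zero_le_one.trans hκ)
  · intro Ω hΩ hcond
    have hmin : 0 < lamMin hΩ.1 := by
      obtain ⟨j, hj⟩ := exists_eq_ciInf_of_finite (f := hΩ.1.eigenvalues)
      exact (hΩ.eigenvalues_pos j).trans_eq hj
    have hev (j : Fin p) : hΩ.1.eigenvalues j ∈ Set.Icc (lamMin hΩ.1) (κ * lamMin hΩ.1) :=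
      ⟨ciInf_le (Set.finite_range _).bddBelow j,
        (le_ciSup (Set.finite_range hΩ.1.eigenvalues).bddAbove j).trans hcond⟩
    obtain ⟨V, hV, hΩV⟩ := hΩ.1.exists_orthogonal_diagonalization
    have hle := sum_le_trace_sub_log_det hQ hV s hΩ.1.eigenvalues _ hΩ.eigenvalues_pos
      fun i j => mul_truncation_sub_log_le (hspos i) hmin (hev j)
    rw [← hΩV, ← hS] at hle
    refine le_trans ?_ ((hustarmin _ hmin).trans hle)
    rw [hS, trace_orthogonal_conj_diagonal_mul_self hQ, det_orthogonal_conj_diagonal hQ,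
      Real.log_prod fun i _ => (hustar.trans_le (hμ i).1).ne', ← Finset.sum_sub_distrib]
end

section
/- Let X be a real symmetric p×p matrix with spectral decomposition X = V diag(d₁, ..., d_p) Vᵀ, V orthogonal, d₁ ≥ ... ≥ d_p. Fix u > 0 and κ ≥ 1. Then the matrix Ω* = V diag(λ*₁, ..., λ*_p) Vᵀ with λ*ᵢ = max(u, min(dᵢ, κu)) minimizes the Frobenius norm ‖Ω − X‖_F over all real symmetric p×p matrices Ω satisfying uI ⪯ Ω ⪯ κuI. -/
open Matrix

/-- The Frobenius norm of a real square matrix, `‖A‖_F = √Tr(AᵀA)`. -/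
noncomputable def frobNorm {p : ℕ} (A : Matrix (Fin p) (Fin p) ℝ) : ℝ :=
  Real.sqrt (Aᵀ * A).trace

theorem trace_transpose_mul_self {p : ℕ} (A : Matrix (Fin p) (Fin p) ℝ) :
    (Aᵀ * A).trace = ∑ i, ∑ j, A j i ^ 2 := by
  simp [Matrix.trace, Matrix.mul_apply, sq]

theorem frobNorm_orthogonal_conj {p : ℕ} {V : Matrix (Fin p) (Fin p) ℝ} (hV : Vᵀ * V = 1)
    (A : Matrix (Fin p) (Fin p) ℝ) : frobNorm (V * A * Vᵀ) = frobNorm A := by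
  have h : (V * A * Vᵀ)ᵀ * (V * A * Vᵀ) = V * (Aᵀ * A) * Vᵀ := by
    calc (V * A * Vᵀ)ᵀ * (V * A * Vᵀ) = V * Aᵀ * (Vᵀ * V) * A * Vᵀ := by
          simp only [transpose_mul, transpose_transpose, Matrix.mul_assoc]
      _ = V * (Aᵀ * A) * Vᵀ := by rw [hV, Matrix.mul_one, Matrix.mul_assoc V]
  rw [frobNorm, frobNorm, h, Matrix.trace_mul_comm, ← Matrix.mul_assoc, hV, Matrix.one_mul]

theorem frobNorm_diagonal_le {p : ℕ} {a : Fin p → ℝ} {A : Matrix (Fin p) (Fin p) ℝ}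
    (h : ∀ i, a i ^ 2 ≤ A i i ^ 2) : frobNorm (diagonal a) ≤ frobNorm A := by
  refine Real.sqrt_le_sqrt ?_
  rw [trace_transpose_mul_self A, diagonal_transpose, diagonal_mul_diagonal, trace_diagonal]
  refine Finset.sum_le_sum fun i _ => ?_
  rw [← sq]
  exact (h i).trans <|
    Finset.single_le_sum (f := fun j => A j i ^ 2) (fun j _ => sq_nonneg _) (Finset.mem_univ i)

/-- Clamping `x` to `[a, b]` gives the point of `[a, b]` closest to `x`. -/
theorem sq_clamp_sub_le {a b x w : ℝ} (ha : a ≤ w) (hb : w ≤ b) :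
    (max a (min x b) - x) ^ 2 ≤ (w - x) ^ 2 := by
  rcases le_total x b with h | h
  · rw [min_eq_left h]
    rcases le_total a x with h' | h'
    · simpa [max_eq_right h'] using sq_nonneg (w - x)
    · rw [max_eq_left h']
      nlinarith
  · rw [min_eq_right h, max_eq_right (ha.trans hb)]
    nlinarith

/-- with `X = V diag(d) Vᵀ` (`V` orthogonal, `d` decreasing), `u > 0`,
`κ ≥ 1`, and `λ*ᵢ = max(u, min(dᵢ, κu))`, the matrix `Ω* = V diag(λ*) Vᵀ` minimizes
`‖Ω − X‖_F` over all real symmetric `Ω` with `uI ⪯ Ω ⪯ κuI`. -/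
theorem stmt10 {p : ℕ} (X V : Matrix (Fin p) (Fin p) ℝ) (d : Fin p → ℝ) (hd : Antitone d)
    (hV : Vᵀ * V = 1) (hX : X = V * Matrix.diagonal d * Vᵀ)
    (u : ℝ) (hu : 0 < u) (κ : ℝ) (hκ : 1 ≤ κ) :
    (V * Matrix.diagonal (fun i => max u (min (d i) (κ * u))) * Vᵀ).IsHermitian ∧
      ((V * Matrix.diagonal (fun i => max u (min (d i) (κ * u))) * Vᵀ) -
        u • (1 : Matrix (Fin p) (Fin p) ℝ)).PosSemidef ∧
      ((κ * u) • (1 : Matrix (Fin p) (Fin p) ℝ) -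
        (V * Matrix.diagonal (fun i => max u (min (d i) (κ * u))) * Vᵀ)).PosSemidef ∧
      ∀ Ω : Matrix (Fin p) (Fin p) ℝ, Ω.IsHermitian →
        (Ω - u • (1 : Matrix (Fin p) (Fin p) ℝ)).PosSemidef →
        ((κ * u) • (1 : Matrix (Fin p) (Fin p) ℝ) - Ω).PosSemidef →
        frobNorm ((V * Matrix.diagonal (fun i => max u (min (d i) (κ * u))) * Vᵀ) - X) ≤
          frobNorm (Ω - X) := by
  have hV' : V * Vᵀ = 1 := mul_eq_one_comm.mp hV
  have hsmul (c : ℝ) : V * diagonal (fun _ => c) * Vᵀ = c • (1 : Matrix (Fin p) (Fin p) ℝ) := by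
    rw [← smul_one_eq_diagonal, Matrix.mul_smul, Matrix.mul_one, Matrix.smul_mul, hV']
  have hpsd {a : Fin p → ℝ} (ha : 0 ≤ a) : (V * diagonal a * Vᵀ).PosSemidef := by
    simpa using (PosSemidef.diagonal ha).mul_mul_conjTranspose_same V
  have huκ : u ≤ κ * u := le_mul_of_one_le_left hu.le hκ
  refine ⟨?_, ?_, ?_, fun Ω _ hlo hhi => ?_⟩
  · exact (hpsd fun i => hu.le.trans (le_max_left _ _)).isHermitian
  · rw [← hsmul, ← Matrix.sub_mul, ← Matrix.mul_sub, diagonal_sub]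
    exact hpsd fun i => sub_nonneg.mpr (le_max_left _ _)
  · rw [← hsmul, ← Matrix.sub_mul, ← Matrix.mul_sub, diagonal_sub]
    exact hpsd fun i => sub_nonneg.mpr (max_le huκ (min_le_right _ _))
  · have hΩ : Ω = V * (Vᵀ * Ω * V) * Vᵀ := by
      rw [Matrix.mul_assoc, Matrix.mul_assoc, hV', Matrix.mul_one, ← Matrix.mul_assoc, hV',
        Matrix.one_mul]
    have hlo' (i : Fin p) : u ≤ (Vᵀ * Ω * V) i i := by
      simpa [Matrix.mul_sub, Matrix.sub_mul, hV] using
        (hlo.conjTranspose_mul_mul_same V).diag_nonneg (i := i)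
    have hhi' (i : Fin p) : (Vᵀ * Ω * V) i i ≤ κ * u := by
      simpa [Matrix.mul_sub, Matrix.sub_mul, hV] using
        (hhi.conjTranspose_mul_mul_same V).diag_nonneg (i := i)
    rw [hX, hΩ, ← Matrix.sub_mul, ← Matrix.mul_sub, ← Matrix.sub_mul, ← Matrix.mul_sub,
      frobNorm_orthogonal_conj hV, frobNorm_orthogonal_conj hV, diagonal_sub]
    refine frobNorm_diagonal_le fun i => ?_
    rw [Matrix.sub_apply, diagonal_apply_eq]
    exact sq_clamp_sub_le (hlo' i) (hhi' i)
end

section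
/- (Path continuity at an upper boundary.) Let d₁ ≥ ... ≥ d_p be reals, κ̄ ≥ 1, and let l₁, ..., l_p : ℝ → ℝ be convex and differentiable on (0,∞). Fix integers 1 ≤ α ≤ p−1 and α+1 ≤ β ≤ p−1, and define l_{α,β}(u) = ∑_{i=1}^{α} l_{p−i+1}(u) − u ∑_{i=1}^{α} d_{p−i+1} + ∑_{i=β}^{p} l_{p−i+1}(κ̄u) − κ̄u ∑_{i=β}^{p} d_{p−i+1}. Suppose ū > 0 is a global minimizer of l_{α,β} over (0,∞), and suppose κ̄ū is a global minimizer over (0,∞) of λ ↦ l_{p−β+1}(λ) − d_{p−β+1}λ. Then ū is a global minimizer over (0,∞) of l_{α,β+1}, defined by the same formula with β replaced by β+1 (the second sums over β+1 ≤ i ≤ p). -/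
open Set

/-- The local objective `l_{α,β}(u) = ∑_{i=1}^{α} l_{p−i+1}(u) − u ∑_{i=1}^{α} d_{p−i+1}
+ ∑_{i=β}^{p} l_{p−i+1}(κu) − κu ∑_{i=β}^{p} d_{p−i+1}` (indices are 1-based). -/
noncomputable def lab (p : ℕ) (l : ℕ → ℝ → ℝ) (d : ℕ → ℝ) (κ : ℝ) (α β : ℕ) (u : ℝ) : ℝ :=
  (∑ i ∈ Finset.Icc 1 α, l (p - i + 1) u) - u * (∑ i ∈ Finset.Icc 1 α, d (p - i + 1)) +
    (∑ i ∈ Finset.Icc β p, l (p - i + 1) (κ * u)) -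
      κ * u * (∑ i ∈ Finset.Icc β p, d (p - i + 1))

/-- If `x` minimizes both `f + g` and `g` on an open set, with `f` convex and `f`, `g`
differentiable at `x`, then `x` minimizes `f`. -/
lemma ConvexOn.isMinOn_of_isMinOn_add {S : Set ℝ} (hS : IsOpen S) {f g : ℝ → ℝ} {x : ℝ}
    (hf : ConvexOn ℝ S f) (hx : x ∈ S) (hfd : DifferentiableAt ℝ f x)
    (hgd : DifferentiableAt ℝ g x) (hfg : IsMinOn (f + g) S x) (hg : IsMinOn g S x) :
    IsMinOn f S x := by
  have hSx := hS.mem_nhds hx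
  have hfg0 := (hfg.isLocalMin hSx).deriv_eq_zero
  have hg0 := (hg.isLocalMin hSx).deriv_eq_zero
  rw [deriv_add hfd hgd, hg0, add_zero] at hfg0
  refine hf.isMinOn_of_rightDeriv_eq_zero (by rwa [hS.interior_eq]) ?_
  rw [hfd.derivWithin (uniqueDiffWithinAt_Ioi x), hfg0]

lemma convexOn_finset_sum {ι : Type*} {S : Set ℝ} (hS : Convex ℝ S) (t : Finset ι)
    (f : ι → ℝ → ℝ) (hf : ∀ i ∈ t, ConvexOn ℝ S (f i)) :
    ConvexOn ℝ S (fun x => ∑ i ∈ t, f i x) := by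
  classical
  induction t using Finset.induction_on with
  | empty => simpa using convexOn_const (0 : ℝ) hS
  | insert a t ha ih =>
    simp only [Finset.sum_insert ha]
    exact (hf a (Finset.mem_insert_self a t)).add
      (ih fun i hi => hf i (Finset.mem_insert_of_mem hi))

lemma ConvexOn.comp_const_mul_Ioi {f : ℝ → ℝ} (hf : ConvexOn ℝ (Ioi 0) f) {κ : ℝ} (hκ : 0 < κ) :
    ConvexOn ℝ (Ioi 0) (fun u => f (κ * u)) :=
  (hf.comp_linearMap (LinearMap.mulLeft ℝ κ)).subset
    (fun _ hu => mul_pos hκ hu) (convex_Ioi 0)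

lemma convexOn_const_mul {S : Set ℝ} (hS : Convex ℝ S) (c : ℝ) :
    ConvexOn ℝ S (fun u => c * u) :=
  (LinearMap.mulLeft ℝ c).convexOn hS

lemma convexOn_lab {p : ℕ} {l : ℕ → ℝ → ℝ} {d : ℕ → ℝ} {κ : ℝ} {α β : ℕ}
    (hl : ∀ i ∈ Finset.Icc 1 p, ConvexOn ℝ (Ioi (0 : ℝ)) (l i)) (hκ : 0 < κ)
    (hα : α ≤ p) (hβ : 1 ≤ β) : ConvexOn ℝ (Ioi (0 : ℝ)) (lab p l d κ α β) := by
  have h₁ := convexOn_finset_sum (convex_Ioi (0 : ℝ)) (Finset.Icc 1 α)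
    (fun i u => l (p - i + 1) u) fun i hi =>
      hl _ (by simp only [Finset.mem_Icc] at hi ⊢; omega)
  have h₂ := convexOn_finset_sum (convex_Ioi (0 : ℝ)) (Finset.Icc β p)
    (fun i u => l (p - i + 1) (κ * u)) fun i hi =>
      (hl _ (by simp only [Finset.mem_Icc] at hi ⊢; omega)).comp_const_mul_Ioi hκ
  have h₃ := convexOn_const_mul (convex_Ioi (0 : ℝ))
    (-(∑ i ∈ Finset.Icc 1 α, d (p - i + 1)) - κ * ∑ i ∈ Finset.Icc β p, d (p - i + 1))
  refine ((h₁.add h₂).add h₃).congr fun u _ => ?_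
  simp only [lab, Pi.add_apply]
  ring

lemma differentiableAt_lab {p : ℕ} {l : ℕ → ℝ → ℝ} {d : ℕ → ℝ} {κ : ℝ} {α β : ℕ}
    (hl : ∀ i ∈ Finset.Icc 1 p, DifferentiableOn ℝ (l i) (Ioi (0 : ℝ))) (hκ : 0 < κ)
    (hα : α ≤ p) (hβ : 1 ≤ β) {u : ℝ} (hu : 0 < u) :
    DifferentiableAt ℝ (lab p l d κ α β) u := by
  have h₁ : DifferentiableAt ℝ (fun u => ∑ i ∈ Finset.Icc 1 α, l (p - i + 1) u) u :=
    DifferentiableAt.fun_sum fun i hi =>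
      (hl _ (by simp only [Finset.mem_Icc] at hi ⊢; omega)).differentiableAt (Ioi_mem_nhds hu)
  have h₂ : DifferentiableAt ℝ (fun u => ∑ i ∈ Finset.Icc β p, l (p - i + 1) (κ * u)) u :=
    DifferentiableAt.fun_sum fun i hi =>
      ((hl _ (by simp only [Finset.mem_Icc] at hi ⊢; omega)).differentiableAt
        (Ioi_mem_nhds (mul_pos hκ hu))).fun_comp' u (by fun_prop)
  unfold lab
  fun_prop

lemma lab_eq_lab_succ_add {p : ℕ} (l : ℕ → ℝ → ℝ) (d : ℕ → ℝ) (κ : ℝ) (α : ℕ) {β : ℕ}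
    (hβ : β ≤ p) (u : ℝ) :
    lab p l d κ α β u =
      lab p l d κ α (β + 1) u + (l (p - β + 1) (κ * u) - d (p - β + 1) * (κ * u)) := by
  simp only [lab, ← Finset.add_sum_Ioc_eq_sum_Icc hβ, ← Finset.Icc_add_one_left_eq_Ioc]
  ring

/-- path continuity at an upper boundary: if `ū > 0` globally minimizes
`l_{α,β}` over `(0,∞)` and `κ̄ū` globally minimizes `λ ↦ l_{p−β+1}(λ) − d_{p−β+1}λ`
over `(0,∞)`, then `ū` globally minimizes `l_{α,β+1}` over `(0,∞)`. -/
theorem stmt13 (p : ℕ) (d : ℕ → ℝ) (hd : ∀ i j, 1 ≤ i → i ≤ j → j ≤ p → d j ≤ d i)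
    (κ : ℝ) (hκ : 1 ≤ κ) (l : ℕ → ℝ → ℝ)
    (hconv : ∀ i ∈ Finset.Icc 1 p, ConvexOn ℝ (Ioi (0 : ℝ)) (l i))
    (hdiff : ∀ i ∈ Finset.Icc 1 p, DifferentiableOn ℝ (l i) (Ioi (0 : ℝ)))
    (α β : ℕ) (hα1 : 1 ≤ α) (hαp : α + 1 ≤ p) (hβ1 : α + 1 ≤ β) (hβp : β + 1 ≤ p)
    (ubar : ℝ) (hubar : 0 < ubar)
    (hmin : ∀ u ∈ Ioi (0 : ℝ), lab p l d κ α β ubar ≤ lab p l d κ α β u)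
    (hsingle : ∀ x ∈ Ioi (0 : ℝ),
      l (p - β + 1) (κ * ubar) - d (p - β + 1) * (κ * ubar) ≤
        l (p - β + 1) x - d (p - β + 1) * x) :
    ∀ u ∈ Ioi (0 : ℝ), lab p l d κ α (β + 1) ubar ≤ lab p l d κ α (β + 1) u := by
  have hκ0 : 0 < κ := by linarith
  have hg : DifferentiableAt ℝ
      (fun u => l (p - β + 1) (κ * u) - d (p - β + 1) * (κ * u)) ubar := by
    have hl : DifferentiableAt ℝ (fun u => l (p - β + 1) (κ * u)) ubar :=
      ((hdiff _ (by simp only [Finset.mem_Icc]; omega)).differentiableAt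
        (Ioi_mem_nhds (mul_pos hκ0 hubar))).fun_comp' ubar (by fun_prop)
    exact hl.fun_sub (by fun_prop)
  refine (convexOn_lab hconv hκ0 (by omega) (by omega)).isMinOn_of_isMinOn_add isOpen_Ioi hubar
    (differentiableAt_lab hdiff hκ0 (by omega) (by omega) hubar) hg (fun u hu => ?_)
    (fun u hu => hsingle (κ * u) (mul_pos hκ0 hu))
  simpa only [mem_ofPred_eq, Pi.add_apply, lab_eq_lab_succ_add l d κ α (by omega : β ≤ p)]
    using hmin u hu
end

section
/- (Convexity of the CONCORD loss.) Let S be a real symmetric positive semidefinite p×p matrix. Then the function h₁(Ω) = −∑ᵢ₌₁ᵖ log(Ωᵢᵢ) + (1/2)·Tr(Ω S Ω) is convex on the convex set of real symmetric p×p matrices Ω whose diagonal entries are all strictly positive. -/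
open Matrix

variable {n : Type*}

theorem convex_diag_pos : Convex ℝ {A : Matrix n n ℝ | ∀ i, 0 < A i i} := by
  intro A hA B hB a b ha hb hab i
  exact convex_Ioi (0 : ℝ) (hA i) (hB i) ha hb hab

theorem convex_isHermitian : Convex ℝ {A : Matrix n n ℝ | A.IsHermitian} := by
  intro A hA B hB a b _ _ _
  exact (hA.smul (.all a)).add (hB.smul (.all b))

theorem convex_isHermitian_diag_pos :
    Convex ℝ {A : Matrix n n ℝ | A.IsHermitian ∧ ∀ i, 0 < A i i} :=
  convex_isHermitian.inter convex_diag_pos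

theorem convexOn_neg_sum_log_diag [Fintype n] :
    ConvexOn ℝ {A : Matrix n n ℝ | ∀ i, 0 < A i i} (fun A => -∑ i, Real.log (A i i)) := by
  refine ⟨convex_diag_pos, fun A hA B hB a b ha hb hab => ?_⟩
  simp only [smul_eq_mul, mul_neg, Finset.mul_sum]
  rw [← neg_add, neg_le_neg_iff, ← Finset.sum_add_distrib]
  exact Finset.sum_le_sum fun i _ =>
    strictConcaveOn_log_Ioi.concaveOn.2 (hA i) (hB i) ha hb hab

theorem convexOn_trace_mul_mul_self [Fintype n] {S : Matrix n n ℝ} (hS : S.PosSemidef) :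
    ConvexOn ℝ {A : Matrix n n ℝ | A.IsHermitian} (fun A => (A * S * A).trace) := by
  refine ⟨convex_isHermitian, fun A hA B hB a b ha hb hab => ?_⟩
  have hnonneg : 0 ≤ ((A - B) * S * (A - B)).trace := by
    have h := (hS.mul_mul_conjTranspose_same (A - B)).trace_nonneg
    rwa [(hA.sub hB).eq] at h
  obtain rfl : b = 1 - a := by linarith
  have key := mul_nonneg (mul_nonneg ha hb) hnonneg
  simp only [sub_mul, mul_sub, add_mul, mul_add, Matrix.smul_mul, Matrix.mul_smul, trace_add,
    trace_sub, trace_smul, smul_eq_mul] at key ⊢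
  linarith

/-- convexity of the CONCORD loss: for real symmetric positive semidefinite
`S`, the function `h₁(Ω) = −∑ᵢ log(Ωᵢᵢ) + (1/2)·Tr(ΩSΩ)` is convex on the convex set of
real symmetric `p × p` matrices with strictly positive diagonal entries. -/
theorem stmt18 {p : ℕ} (S : Matrix (Fin p) (Fin p) ℝ) (hS : S.PosSemidef) :
    ConvexOn ℝ {Ω : Matrix (Fin p) (Fin p) ℝ | Ω.IsHermitian ∧ ∀ i, 0 < Ω i i}
      (fun Ω => -(∑ i, Real.log (Ω i i)) + (1 / 2) * (Ω * S * Ω).trace) := by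
  have hconv := convex_isHermitian_diag_pos (n := Fin p)
  refine ConvexOn.add (convexOn_neg_sum_log_diag.subset (fun _ h => h.2) hconv) ?_
  exact ((convexOn_trace_mul_mul_self hS).subset (fun _ h => h.1) hconv).smul
    (by norm_num : (0 : ℝ) ≤ 1 / 2)
end
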